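/- arXiv:1508.02266 — 6 statements merged into one kernel-verified Lean document; each statement's English description precedes it below -/
import Mathlib

section
/- Let {f_i}_{i=1}^k be a sequence of vectors in ℝ^n (n ≥ 2), not all of which are zero. Then {f_i}_{i=1}^k is a tight frame for ℝ^n (i.e., there is a constant A > 0 with Σ_{i=1}^k ⟨f, f_i⟩² = A‖f‖² for all f ∈ ℝ^n) if and only if Σ_{i=1}^k f̃_i = 0, where f̃_i denotes the diagram vector of f_i. -/
open Finset

/-- The diagram vector of `f ∈ ℝⁿ`: entries `(f i ^ 2 - f j ^ 2)/√(n-1)` and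
`√(2n) f i * f j / √(n-1)`, each occurring exactly once for `i < j`
(entries with `¬ i < j` are padded with zeros). -/
noncomputable def diagram (n : ℕ) (f : Fin n → ℝ) :
    (Fin n × Fin n) ⊕ (Fin n × Fin n) → ℝ := fun x =>
  (1 / Real.sqrt ((n : ℝ) - 1)) *
    (match x with
      | Sum.inl (i, j) => if i < j then f i ^ 2 - f j ^ 2 else 0
      | Sum.inr (i, j) => if i < j then Real.sqrt (2 * (n : ℝ)) * (f i * f j) else 0)

theorem sum_sq_sum_mul_eq_gram {ι κ : Type*} [Fintype ι] [Fintype κ]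
    (f : κ → ι → ℝ) (x : ι → ℝ) :
    ∑ i, (∑ l, x l * f i l) ^ 2 = ∑ a, ∑ b, x a * x b * ∑ i, f i a * f i b := by
  simp_rw [sq, Finset.sum_mul_sum, Finset.mul_sum]
  rw [Finset.sum_comm]
  refine Finset.sum_congr rfl fun a _ => ?_
  rw [Finset.sum_comm]
  refine Finset.sum_congr rfl fun b _ => Finset.sum_congr rfl fun i _ => ?_
  ring

/-- A family satisfies the tight frame identity with constant `A` if and only if its frame
operator is `A` times the identity matrix. -/
theorem tight_frame_identity_iff {ι κ : Type*} [Fintype ι] [Fintype κ] [DecidableEq ι]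
    (f : κ → ι → ℝ) (A : ℝ) :
    (∀ x : ι → ℝ, ∑ i, (∑ l, x l * f i l) ^ 2 = A * ∑ l, x l ^ 2) ↔
      ∀ a b, ∑ i, f i a * f i b = if a = b then A else 0 := by
  constructor
  · intro h
    have diag : ∀ a, ∑ i, f i a * f i a = A := by
      intro a
      have := h (Pi.single a 1)
      simpa [Pi.single_apply, sq] using this
    intro a b
    split_ifs with hab
    · subst hab
      exact diag a
    · have key := h (Pi.single a 1 + Pi.single b 1)
      have hl : ∀ i, ∑ l, (Pi.single a 1 + Pi.single b 1 : ι → ℝ) l * f i l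
          = f i a + f i b := fun i => by
        simp [Pi.single_apply, add_mul, Finset.sum_add_distrib]
      have hr : ∑ l, (Pi.single a 1 + Pi.single b 1 : ι → ℝ) l ^ 2 = 2 := by
        have hba : b ≠ a := Ne.symm hab
        simp [Pi.single_apply, add_sq, Finset.sum_add_distrib, hba]
        norm_num
      simp_rw [hl] at key
      rw [hr] at key
      have expand : ∑ i, (f i a + f i b) ^ 2
          = ∑ i, f i a * f i a + 2 * ∑ i, f i a * f i b + ∑ i, f i b * f i b := by
        rw [Finset.mul_sum, ← Finset.sum_add_distrib, ← Finset.sum_add_distrib]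
        exact Finset.sum_congr rfl fun i _ => by ring
      rw [expand, diag, diag] at key
      linarith
  · intro h x
    rw [sum_sq_sum_mul_eq_gram]
    simp [h, Finset.mul_sum, sq, mul_comm]

theorem sum_diagram_eq_zero_iff (n k : ℕ) (hn : 2 ≤ n) (f : Fin k → Fin n → ℝ) :
    ∑ i, diagram n (f i) = 0 ↔
      ∀ a b, a < b → ∑ i, f i a * f i a = ∑ i, f i b * f i b ∧ ∑ i, f i a * f i b = 0 := by
  have hn' : (2 : ℝ) ≤ n := by exact_mod_cast hn
  have hc : Real.sqrt ((n : ℝ) - 1) ≠ 0 := (Real.sqrt_pos.2 (by linarith)).ne'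
  have hd : Real.sqrt (2 * (n : ℝ)) ≠ 0 := (Real.sqrt_pos.2 (by linarith)).ne'
  have hl : ∀ a b, (∑ i, diagram n (f i)) (Sum.inl (a, b)) = 0 ↔
      (a < b → ∑ i, f i a * f i a = ∑ i, f i b * f i b) := by
    intro a b
    rw [Finset.sum_apply]
    simp only [diagram, ← Finset.mul_sum]
    by_cases h : a < b
    · simp [h, hc, sq, sub_eq_zero]
    · simp [h]
  have hr : ∀ a b, (∑ i, diagram n (f i)) (Sum.inr (a, b)) = 0 ↔
      (a < b → ∑ i, f i a * f i b = 0) := by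
    intro a b
    rw [Finset.sum_apply]
    simp only [diagram, ← Finset.mul_sum]
    by_cases h : a < b
    · simp only [h, if_true, ← Finset.mul_sum, mul_eq_zero, one_div, inv_eq_zero, hc, hd,
        false_or, true_imp_iff]
    · simp [h]
  rw [funext_iff]
  constructor
  · intro h a b hab
    exact ⟨(hl a b).1 (h _) hab, (hr a b).1 (h _) hab⟩
  · rintro h (⟨a, b⟩ | ⟨a, b⟩)
    · exact (hl a b).2 fun hab => (h a b hab).1
    · exact (hr a b).2 fun hab => (h a b hab).2

/-- A sequence of vectors in `ℝⁿ` (`n ≥ 2`), not all zero, is a tight frame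
if and only if the sum of the diagram vectors is zero. -/
theorem diagram_tight_frame_characterization (n k : ℕ) (hn : 2 ≤ n)
    (f : Fin k → Fin n → ℝ) (hf : ∃ i, f i ≠ 0) :
    (∃ A : ℝ, 0 < A ∧ ∀ x : Fin n → ℝ,
        ∑ i, (∑ l, x l * f i l) ^ 2 = A * ∑ l, x l ^ 2) ↔
      ∑ i, diagram n (f i) = 0 := by
  simp_rw [tight_frame_identity_iff, sum_diagram_eq_zero_iff n k hn]
  constructor
  · rintro ⟨A, -, h⟩ a b hab
    simp [h, hab.ne]
  · intro h
    obtain ⟨i, hi⟩ := hf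
    obtain ⟨c, hc⟩ := Function.ne_iff.1 hi
    refine ⟨∑ i, f i c * f i c, ?_, fun a b => ?_⟩
    · exact Finset.sum_pos' (fun j _ => mul_self_nonneg _)
        ⟨i, Finset.mem_univ i, mul_self_pos.2 hc⟩
    · split_ifs with hab
      · subst hab
        rcases lt_trichotomy a c with hac | rfl | hca
        · exact (h a c hac).1
        · rfl
        · exact (h c a hca).1.symm
      · rcases lt_or_gt_of_ne hab with hlt | hgt
        · exact (h a b hlt).2
        · simpa only [mul_comm] using (h b a hgt).2
end

section
/- Let F = {f_i}_{i=1}^k be a unit-norm frame for ℝ^n (n ≥ 2) and let c = (c(1),…,c(k)) ∈ ℝ^k with c(i) ≥ 0 for all i. Let G̃ = (⟨f̃_j, f̃_i⟩)_{i,j=1}^k be the Gramian matrix of the diagram vectors f̃_1,…,f̃_k. Then the scaled system {√c(i)·f_i}_{i=1}^k is a Parseval frame for ℝ^n if and only if G̃c = 0 and c(1) + ⋯ + c(k) = n. -/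
open Finset

/-- `f` is a unit-norm frame for `ℝⁿ`: a finite spanning family of unit vectors. -/
def IsUnitNormFrame {n k : ℕ} (f : Fin k → Fin n → ℝ) : Prop :=
  (∀ i, ∑ l, f i l ^ 2 = 1) ∧ Submodule.span ℝ (Set.range f) = ⊤

lemma gramian_mulVec_eq_zero_iff {ι κ : Type*} [Fintype ι] [Fintype κ]
    (v : κ → ι → ℝ) (c : κ → ℝ) :
    Matrix.mulVec (Matrix.of fun i j : κ => ∑ x, v j x * v i x) c = 0 ↔
      ∀ x, ∑ j, c j * v j x = 0 := by
  have hG : (Matrix.of fun i j : κ => ∑ x, v j x * v i x) =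
      (Matrix.of fun x j => v j x).conjTranspose * (Matrix.of fun x j => v j x) := by
    ext i j
    simp [Matrix.mul_apply, mul_comm]
  rw [hG, Matrix.conjTranspose_mul_self_mulVec_eq_zero, funext_iff]
  simp [Matrix.mulVec, dotProduct, mul_comm]

/-- The weighted sum of diagram vectors vanishes iff the weighted frame operator has constant
diagonal and vanishing off-diagonal entries. -/
lemma sum_mul_diagram_eq_zero_iff {n k : ℕ} (hn : 2 ≤ n) (f : Fin k → Fin n → ℝ)
    (c : Fin k → ℝ) :
    (∀ x, ∑ l, c l * diagram n (f l) x = 0) ↔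
      ∀ i j, i < j → ∑ l, c l * f l i ^ 2 = ∑ l, c l * f l j ^ 2 ∧
        ∑ l, c l * (f l i * f l j) = 0 := by
  have hn' : (2 : ℝ) ≤ n := by exact_mod_cast hn
  have h₁ : 1 / Real.sqrt ((n : ℝ) - 1) ≠ 0 :=
    (one_div_pos.2 (Real.sqrt_pos.2 (by linarith))).ne'
  have h₂ : Real.sqrt (2 * (n : ℝ)) ≠ 0 := (Real.sqrt_pos.2 (by linarith)).ne'
  have hl (i j : Fin n) (hij : i < j) : ∑ l, c l * diagram n (f l) (Sum.inl (i, j)) =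
      1 / Real.sqrt ((n : ℝ) - 1) * (∑ l, c l * f l i ^ 2 - ∑ l, c l * f l j ^ 2) := by
    rw [← Finset.sum_sub_distrib, Finset.mul_sum]
    refine Finset.sum_congr rfl fun l _ => ?_
    simp only [diagram, if_pos hij]
    ring
  have hr (i j : Fin n) (hij : i < j) : ∑ l, c l * diagram n (f l) (Sum.inr (i, j)) =
      1 / Real.sqrt ((n : ℝ) - 1) * Real.sqrt (2 * (n : ℝ)) * ∑ l, c l * (f l i * f l j) := by
    rw [Finset.mul_sum]
    refine Finset.sum_congr rfl fun l _ => ?_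
    simp only [diagram, if_pos hij]
    ring
  constructor
  · intro h i j hij
    have hL := h (Sum.inl (i, j))
    have hR := h (Sum.inr (i, j))
    rw [hl i j hij] at hL
    rw [hr i j hij] at hR
    exact ⟨sub_eq_zero.1 ((mul_eq_zero.1 hL).resolve_left h₁),
      (mul_eq_zero.1 hR).resolve_left (mul_ne_zero h₁ h₂)⟩
  · rintro h (⟨i, j⟩ | ⟨i, j⟩) <;> by_cases hij : i < j
    · rw [hl i j hij, (h i j hij).1, sub_self, mul_zero]
    · simp [diagram, hij]
    · rw [hr i j hij, (h i j hij).2, mul_zero]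
    · simp [diagram, hij]

/-- Let `F = {f_i}` be a unit-norm frame for `ℝⁿ` (`n ≥ 2`) and `c ∈ ℝᵏ` entrywise
nonnegative.  Let `G̃` be the Gramian of the diagram vectors.  Then the scaled system
`{√c(i)·f_i}` is a Parseval frame iff `G̃ c = 0` and `c(1) + ⋯ + c(k) = n`. -/
theorem scaling_iff_gramian_nullspace (n k : ℕ) (hn : 2 ≤ n)
    (f : Fin k → Fin n → ℝ) (hF : IsUnitNormFrame f)
    (c : Fin k → ℝ) (hc : ∀ i, 0 ≤ c i) :
    (∑ i, Matrix.vecMulVec (Real.sqrt (c i) • f i) (Real.sqrt (c i) • f i) =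
        (1 : Matrix (Fin n) (Fin n) ℝ)) ↔
      (Matrix.mulVec
          (Matrix.of fun i j : Fin k => ∑ x, diagram n (f j) x * diagram n (f i) x) c = 0 ∧
        ∑ i, c i = (n : ℝ)) := by
  rw [gramian_mulVec_eq_zero_iff (fun i => diagram n (f i)) c, sum_mul_diagram_eq_zero_iff hn]
  have hS (i j : Fin n) :
      (∑ l, Matrix.vecMulVec (Real.sqrt (c l) • f l) (Real.sqrt (c l) • f l)) i j =
        ∑ l, c l * (f l i * f l j) := by
    rw [Matrix.sum_apply]
    refine Finset.sum_congr rfl fun l _ => ?_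
    simp only [Matrix.vecMulVec_apply, Pi.smul_apply, smul_eq_mul]
    rw [mul_mul_mul_comm, Real.mul_self_sqrt (hc l)]
  have htrace : ∑ l, c l = ∑ i, ∑ l, c l * f l i ^ 2 := by
    rw [Finset.sum_comm]
    refine Finset.sum_congr rfl fun l _ => ?_
    rw [← Finset.mul_sum, hF.1 l, mul_one]
  rw [htrace, ← Matrix.ext_iff]
  simp only [hS]
  constructor
  · intro h
    have hd (i : Fin n) : ∑ l, c l * f l i ^ 2 = 1 := by simpa [sq] using h i i
    refine ⟨fun i j hij => ⟨by rw [hd, hd], by rw [h, Matrix.one_apply_ne hij.ne]⟩, ?_⟩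
    simp [hd]
  · rintro ⟨h, hsum⟩ i j
    rcases lt_trichotomy i j with hij | rfl | hij
    · rw [(h i j hij).2, Matrix.one_apply_ne hij.ne]
    · have hconst (j : Fin n) : ∑ l, c l * f l j ^ 2 = ∑ l, c l * f l i ^ 2 := by
        rcases lt_trichotomy i j with hij | rfl | hij
        · exact (h i j hij).1.symm
        · rfl
        · exact (h j i hij).1
      have hn0 : (n : ℝ) ≠ 0 := by
        exact_mod_cast (by omega : n ≠ 0)
      simp only [hconst, Finset.sum_const, Finset.card_univ, Fintype.card_fin,
        nsmul_eq_mul] at hsum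
      simpa [sq] using mul_left_cancel₀ hn0 (hsum.trans (mul_one _).symm)
    · rw [Matrix.one_apply_ne hij.ne', ← (h j i hij).2]
      simp only [mul_comm (f _ i)]
end

section
/- Let F = {f_i}_{i=1}^k be a unit-norm frame for ℝ^n. Then the set 𝒞(F) of all scalings of F equals the convex hull of the set ℳ(F) of all minimal scalings of F. -/
open Finset

/-- `c` is a scaling of the unit-norm frame `f`:
`c` is entrywise nonnegative and `∑ c i • f_i f_iᵗ = I`. -/
def IsScaling {n k : ℕ} (f : Fin k → Fin n → ℝ) (c : Fin k → ℝ) : Prop :=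
  (∀ i, 0 ≤ c i) ∧
    ∑ i, c i • Matrix.vecMulVec (f i) (f i) = (1 : Matrix (Fin n) (Fin n) ℝ)

/-- The support of a vector `c ∈ ℝᵏ`. -/
noncomputable def suppF {k : ℕ} (c : Fin k → ℝ) : Finset (Fin k) :=
  Finset.univ.filter (fun i => c i ≠ 0)

/-- `c` is a minimal scaling of `f`: it is a scaling and `{f_i : c i > 0}` has no
proper scalable subframe. -/
def IsMinimalScaling {n k : ℕ} (f : Fin k → Fin n → ℝ) (c : Fin k → ℝ) : Prop :=
  IsScaling f c ∧
    ∀ S : Finset (Fin k), S ⊂ suppF c →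
      ¬ ∃ d : Fin k → ℝ, (∀ i, 0 ≤ d i) ∧ (∀ i, i ∉ S → d i = 0) ∧
        ∑ i, d i • Matrix.vecMulVec (f i) (f i) = (1 : Matrix (Fin n) (Fin n) ℝ)

theorem IsScaling.sum_eq {n k : ℕ} {f : Fin k → Fin n → ℝ} (hf : ∀ i, ∑ l, f i l ^ 2 = 1)
    {c : Fin k → ℝ} (hc : IsScaling f c) : ∑ i, c i = n := by
  have h := congrArg Matrix.trace hc.2
  simpa [Matrix.trace_sum, Matrix.trace_vecMulVec, dotProduct, ← pow_two, hf] using h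

theorem convex_setOf_isScaling {n k : ℕ} (f : Fin k → Fin n → ℝ) :
    Convex ℝ {c : Fin k → ℝ | IsScaling f c} := by
  rintro c ⟨hc, hcf⟩ d ⟨hd, hdf⟩ a b ha hb hab
  refine ⟨fun i => add_nonneg (mul_nonneg ha (hc i)) (mul_nonneg hb (hd i)), ?_⟩
  simp only [Pi.add_apply, Pi.smul_apply, add_smul, smul_assoc, sum_add_distrib, ← smul_sum,
    hcf, hdf]
  rw [← add_smul, hab, one_smul]

theorem mem_suppF {k : ℕ} {c : Fin k → ℝ} {i : Fin k} : i ∈ suppF c ↔ c i ≠ 0 := by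
  simp [suppF]

/-- A scaling whose support properly contains that of another scaling `d` lies on a segment from
`d` to a third scaling of smaller support. -/
theorem IsScaling.exists_mem_segment {n k : ℕ} {f : Fin k → Fin n → ℝ}
    (hf : ∀ i, ∑ l, f i l ^ 2 = 1) {c d : Fin k → ℝ} (hc : IsScaling f c) (hd : IsScaling f d)
    (hdc : suppF d ⊂ suppF c) :
    ∃ e, IsScaling f e ∧ suppF e ⊂ suppF c ∧ c ∈ segment ℝ d e := by
  have hsum : ∑ i, d i = ∑ i, c i := by rw [hd.sum_eq hf, hc.sum_eq hf]
  have eq_of_le (h : ∀ i, d i ≤ c i) : d = c := by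
    funext i
    exact (sum_eq_sum_iff_of_le fun i _ => h i).1 hsum i (mem_univ i)
  have hne : (suppF d).Nonempty := by
    rw [nonempty_iff_ne_empty]
    intro hempty
    have hz (i : Fin k) : d i = 0 := by
      by_contra hi
      simpa [hempty] using mem_suppF.2 hi
    exact hdc.ne (congrArg suppF (eq_of_le fun i => (hz i).trans_le (hc.1 i)))
  have hpos {i : Fin k} (hi : i ∈ suppF d) : 0 < d i :=
    lt_of_le_of_ne (hd.1 i) (mem_suppF.1 hi).symm
  obtain ⟨j, hj, hmin⟩ := exists_min_image (suppF d) (fun i => c i / d i) hne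
  set t := c j / d j with ht
  have ht0 : 0 ≤ t := div_nonneg (hc.1 j) (hd.1 j)
  have hle (i : Fin k) : t * d i ≤ c i := by
    by_cases hi : i ∈ suppF d
    · exact (le_div_iff₀ (hpos hi)).1 (hmin i hi)
    · rw [not_not.1 (mt mem_suppF.2 hi), mul_zero]
      exact hc.1 i
  have ht1 : t < 1 := by
    by_contra! h
    refine hdc.ne (congrArg suppF (eq_of_le fun i => ?_))
    exact (le_mul_of_one_le_left (hd.1 i) h).trans (hle i)
  have hs : 0 < 1 - t := sub_pos.2 ht1
  refine ⟨fun i => (1 - t)⁻¹ * (c i - t * d i), ⟨fun i => ?_, ?_⟩, ?_, ?_⟩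
  · exact mul_nonneg (inv_nonneg.2 hs.le) (sub_nonneg.2 (hle i))
  · simp only [mul_smul, sub_smul, ← smul_sum, sum_sub_distrib, hc.2, hd.2]
    nth_rewrite 1 [← one_smul ℝ (1 : Matrix (Fin n) (Fin n) ℝ)]
    rw [← sub_smul, smul_smul, inv_mul_cancel₀ hs.ne', one_smul]
  · refine (ssubset_iff_of_subset fun i hi => ?_).2 ⟨j, hdc.subset hj, ?_⟩
    · by_contra hci
      have hdi : d i = 0 := not_not.1 (mt mem_suppF.2 fun h => hci (hdc.subset h))
      have hci : c i = 0 := not_not.1 (mt mem_suppF.2 hci)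
      exact mem_suppF.1 hi (by simp [hdi, hci])
    · simp [mem_suppF, ht, div_mul_cancel₀ _ (hpos hj).ne']
  · refine ⟨t, 1 - t, ht0, hs.le, by ring, funext fun i => ?_⟩
    simp only [Pi.add_apply, Pi.smul_apply, smul_eq_mul, mul_inv_cancel_left₀ hs.ne']
    ring

theorem IsScaling.mem_convexHull_minimal {n k : ℕ} {f : Fin k → Fin n → ℝ}
    (hf : ∀ i, ∑ l, f i l ^ 2 = 1) {c : Fin k → ℝ} (hc : IsScaling f c) :
    c ∈ convexHull ℝ {c : Fin k → ℝ | IsMinimalScaling f c} := by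
  induction hS : suppF c using Finset.strongInduction generalizing c with
  | H S ih =>
    subst hS
    by_cases hmin : IsMinimalScaling f c
    · exact subset_convexHull ℝ _ hmin
    obtain ⟨S, hS, d, hd0, hdS, hdf⟩ : ∃ S ⊂ suppF c, ∃ d : Fin k → ℝ, (∀ i, 0 ≤ d i) ∧
        (∀ i, i ∉ S → d i = 0) ∧
        ∑ i, d i • Matrix.vecMulVec (f i) (f i) = (1 : Matrix (Fin n) (Fin n) ℝ) := by
      by_contra! h
      exact hmin ⟨hc, fun S hS ⟨d, h0, h1, h2⟩ => h S hS d h0 h1 h2⟩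
    have hd : IsScaling f d := ⟨hd0, hdf⟩
    have hdc : suppF d ⊂ suppF c :=
      lt_of_le_of_lt (fun i hi => by_contra fun h => mem_suppF.1 hi (hdS i h)) hS
    obtain ⟨e, he, hec, hseg⟩ := hc.exists_mem_segment hf hd hdc
    exact (convex_convexHull ℝ _).segment_subset (ih _ hdc hd rfl) (ih _ hec he rfl) hseg

/-- The set of scalings of a unit-norm frame is the convex hull of its set of
minimal scalings. -/
theorem scalings_eq_convexHull_minimal (n k : ℕ)
    (f : Fin k → Fin n → ℝ) (hF : IsUnitNormFrame f) :
    {c : Fin k → ℝ | IsScaling f c} =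
      convexHull ℝ {c : Fin k → ℝ | IsMinimalScaling f c} := by
  refine Set.Subset.antisymm (fun c hc => hc.mem_convexHull_minimal hF.1) ?_
  exact convexHull_min (fun c hc => hc.1) (convex_setOf_isScaling f)
end

section
/- Let F = {f_i}_{i=1}^k be a unit-norm frame for ℝ^n (n ≥ 2) and let G̃ = (⟨f̃_j, f̃_i⟩)_{i,j=1}^k be the Gramian matrix of the diagram vectors. Then the number of minimal scalings of F satisfies |ℳ(F)| ≤ C(k, rank(G̃) + 1), the binomial coefficient 'k choose rank(G̃)+1'. -/
open Finset

/-- The outer product of a vector of unit norm has trace `1`. -/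
theorem trace_vecMulVec_self_eq_one {n : ℕ} {v : Fin n → ℝ} (hv : ∑ l, v l ^ 2 = 1) :
    (Matrix.vecMulVec v v).trace = 1 := by
  simpa [Matrix.trace, Matrix.vecMulVec_apply, sq] using hv

/-- The outer products indexed by the support of a minimal scaling are linearly independent. -/
theorem IsMinimalScaling.linearIndepOn {n k : ℕ} {f : Fin k → Fin n → ℝ} {c : Fin k → ℝ}
    (hf : ∀ i, ∑ l, f i l ^ 2 = 1) (hc : IsMinimalScaling f c) :
    LinearIndepOn ℝ (fun i => Matrix.vecMulVec (f i) (f i)) (suppF c : Set (Fin k)) := by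
  obtain ⟨⟨hnn, hsum⟩, hmin⟩ := hc
  by_contra hdep
  rw [not_linearIndepOn_finset_iff] at hdep
  obtain ⟨a, ha, i, hi, hai⟩ := hdep
  have htr : ∑ i ∈ suppF c, a i = 0 := by
    have h := congrArg Matrix.trace ha
    simpa [Matrix.trace_sum, Matrix.trace_smul, trace_vecMulVec_self_eq_one (hf _)] using h
  obtain ⟨p, hp, hap⟩ := Finset.exists_pos_of_sum_zero_of_exists_nonzero a htr ⟨i, hi, hai⟩
  obtain ⟨m, hm, hmle⟩ := ((suppF c).filter (fun i => 0 < a i)).exists_min_image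
    (fun i => c i / a i) ⟨p, by simp [hp, hap]⟩
  rw [Finset.mem_filter] at hm
  have ht : 0 ≤ c m / a m := div_nonneg (hnn m) hm.2.le
  refine hmin ((suppF c).erase m) (Finset.erase_ssubset hm.1)
    ⟨fun i => c i - c m / a m * (if i ∈ suppF c then a i else 0), fun i => ?_, fun i hi => ?_, ?_⟩
  · by_cases his : i ∈ suppF c
    · simp only [his, if_true]
      rcases lt_or_ge 0 (a i) with h | h
      · have := hmle i (by simp [his, h])
        rw [le_div_iff₀ h] at this
        linarith
      · have := mul_nonpos_of_nonneg_of_nonpos ht h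
        linarith [hnn i]
    · simpa [his] using hnn i
  · by_cases him : i = m
    · subst him
      simp [hm.1, div_mul_cancel₀ _ hm.2.ne']
    · have his : i ∉ suppF c := fun h => hi (Finset.mem_erase.2 ⟨him, h⟩)
      have hci : c i = 0 := by simpa [suppF] using his
      simp [his, hci]
  · have key : ∑ i, (if i ∈ suppF c then a i else 0) • Matrix.vecMulVec (f i) (f i) = 0 := by
      rw [← ha]
      simp [ite_smul, Finset.sum_ite_mem]
    simp only [sub_smul, mul_smul, Finset.sum_sub_distrib, ← Finset.smul_sum]
    rw [key, hsum]
    simp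

/-- A linearly independent subfamily of a finite family extends to one whose cardinality is the
dimension of the span of the family. -/
theorem LinearIndepOn.exists_superset_card_eq_finrank_span {K V ι : Type*} [Field K]
    [AddCommGroup V] [Module K V] [Fintype ι] {v : ι → V} {s : Finset ι}
    (hs : LinearIndepOn K v (s : Set ι)) :
    ∃ b : Finset ι, s ⊆ b ∧ LinearIndepOn K v (b : Set ι) ∧
      b.card = Module.finrank K (Submodule.span K (Set.range v)) := by
  classical
  obtain ⟨b, -, hsb, hspan, hb⟩ := exists_linearIndepOn_extension hs (Set.subset_univ _)
  refine ⟨b.toFinset, by simpa [← Finset.coe_subset] using hsb, by simpa using hb, ?_⟩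
  have hspan' : Submodule.span K (Set.range v) =
      Submodule.span K (Set.range fun i : b => v i) := by
    apply le_antisymm
    · rw [Submodule.span_le, ← Set.image_univ, ← Set.image_eq_range]
      exact hspan
    · exact Submodule.span_mono (by rintro _ ⟨i, rfl⟩; exact ⟨i, rfl⟩)
  rw [hspan', finrank_span_eq_card hb, Set.toFinset_card]

/-- A real-valued combination of diagram vectors vanishes exactly when the corresponding
combination of outer products is a multiple of the identity. -/
theorem sum_smul_diagram_eq_zero_iff {n k : ℕ} (hn : 2 ≤ n) (f : Fin k → Fin n → ℝ)
    (c : Fin k → ℝ) :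
    (∀ x, ∑ j, diagram n (f j) x * c j = 0) ↔
      ∃ t : ℝ, t • (1 : Matrix (Fin n) (Fin n) ℝ) =
        ∑ j, c j • Matrix.vecMulVec (f j) (f j) := by
  have hn' : (2 : ℝ) ≤ n := by exact_mod_cast hn
  have h1 : 1 / Real.sqrt ((n : ℝ) - 1) ≠ 0 :=
    one_div_ne_zero (Real.sqrt_ne_zero'.2 (by linarith))
  have h2 : Real.sqrt (2 * (n : ℝ)) ≠ 0 := Real.sqrt_ne_zero'.2 (by linarith)
  have hent : ∀ p q, (∑ j, c j • Matrix.vecMulVec (f j) (f j)) p q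
      = ∑ j, c j * (f j p * f j q) := fun p q => by
    simp [Matrix.sum_apply, Matrix.vecMulVec_apply]
  have hinl : ∀ p q, p < q → ∑ j, diagram n (f j) (Sum.inl (p, q)) * c j =
      1 / Real.sqrt ((n : ℝ) - 1) *
        (∑ j, c j * (f j p * f j p) - ∑ j, c j * (f j q * f j q)) := fun p q hpq => by
    rw [← Finset.sum_sub_distrib, Finset.mul_sum]
    refine Finset.sum_congr rfl fun j _ => ?_
    simp only [diagram, hpq, if_true]
    ring
  have hinr : ∀ p q, p < q → ∑ j, diagram n (f j) (Sum.inr (p, q)) * c j =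
      1 / Real.sqrt ((n : ℝ) - 1) * Real.sqrt (2 * (n : ℝ)) *
        ∑ j, c j * (f j p * f j q) := fun p q hpq => by
    rw [Finset.mul_sum]
    refine Finset.sum_congr rfl fun j _ => ?_
    simp only [diagram, hpq, if_true]
    ring
  constructor
  · intro h
    have hdiag : ∀ p q, p < q →
        ∑ j, c j * (f j p * f j p) = ∑ j, c j * (f j q * f j q) := fun p q hpq => by
      have := h (Sum.inl (p, q))
      rw [hinl p q hpq] at this
      exact sub_eq_zero.1 ((mul_eq_zero.1 this).resolve_left h1)
    have hoff : ∀ p q, p < q → ∑ j, c j * (f j p * f j q) = 0 := fun p q hpq => by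
      have := h (Sum.inr (p, q))
      rw [hinr p q hpq] at this
      exact (mul_eq_zero.1 this).resolve_left (mul_ne_zero h1 h2)
    let z : Fin n := ⟨0, by omega⟩
    refine ⟨∑ j, c j * (f j z * f j z), ?_⟩
    ext p q
    rw [hent, Matrix.smul_apply, Matrix.one_apply]
    rcases lt_trichotomy p q with hpq | rfl | hpq
    · simp [hpq.ne, hoff p q hpq]
    · rcases (show z ≤ p from Nat.zero_le _).eq_or_lt with hz | hz
      · simp [hz]
      · simp [hdiag z p hz]
    · simp only [hpq.ne', if_false, smul_zero, mul_comm (f _ p), hoff q p hpq]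
  · rintro ⟨t, ht⟩ x
    have hval : ∀ p q, ∑ j, c j * (f j p * f j q) = if p = q then t else 0 := fun p q => by
      rw [← hent, ← ht, Matrix.smul_apply, Matrix.one_apply]
      simp
    rcases x with ⟨p, q⟩ | ⟨p, q⟩
    · by_cases hpq : p < q
      · simp [hinl p q hpq, hval]
      · simp [diagram, hpq]
    · by_cases hpq : p < q
      · simp [hinr p q hpq, hval, hpq.ne]
      · simp [diagram, hpq]

/-- For a scalable family, the outer products span a space of dimension one more than the
rank of the Gramian of the diagram vectors. -/
theorem IsScaling.finrank_span_vecMulVec {n k : ℕ} (hn : 2 ≤ n) {f : Fin k → Fin n → ℝ}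
    {c : Fin k → ℝ} (hc : IsScaling f c) :
    Module.finrank ℝ (Submodule.span ℝ (Set.range fun i => Matrix.vecMulVec (f i) (f i))) =
      (Matrix.of fun i j : Fin k => ∑ x, diagram n (f j) x * diagram n (f i) x).rank + 1 := by
  have : Nonempty (Fin n) := ⟨⟨0, by omega⟩⟩
  set A : Matrix ((Fin n × Fin n) ⊕ (Fin n × Fin n)) (Fin k) ℝ :=
    Matrix.of fun x j => diagram n (f j) x with hA
  have hgram : (Matrix.of fun i j : Fin k => ∑ x, diagram n (f j) x * diagram n (f i) x) =
      A.transpose * A := by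
    ext i j
    simp [hA, Matrix.mul_apply, mul_comm]
  rw [hgram, Matrix.rank_transpose_mul_self]
  set L := Fintype.linearCombination ℝ (fun i => Matrix.vecMulVec (f i) (f i)) with hL
  have hLc : L c = 1 := by simpa [hL, Fintype.linearCombination_apply] using hc.2
  have hmem : ∀ a, a ∈ LinearMap.ker A.mulVecLin ↔
      ∃ t : ℝ, t • (1 : Matrix (Fin n) (Fin n) ℝ) = L a := fun a => by
    rw [hL, Fintype.linearCombination_apply, ← sum_smul_diagram_eq_zero_iff hn, LinearMap.mem_ker,
      funext_iff]
    simp [hA, Matrix.mulVec, dotProduct]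
  have hsup : LinearMap.ker A.mulVecLin = LinearMap.ker L ⊔ Submodule.span ℝ {c} := by
    ext a
    rw [hmem, Submodule.mem_sup]
    constructor
    · rintro ⟨t, ht⟩
      refine ⟨a - t • c, ?_, t • c, Submodule.mem_span_singleton.2 ⟨t, rfl⟩, by simp⟩
      rw [LinearMap.mem_ker, map_sub, map_smul, hLc, ht, sub_self]
    · rintro ⟨y, hy, z, hz, rfl⟩
      obtain ⟨t, rfl⟩ := Submodule.mem_span_singleton.1 hz
      exact ⟨t, by rw [map_add, LinearMap.mem_ker.1 hy, map_smul, hLc, zero_add]⟩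
  have hinf : LinearMap.ker L ⊓ Submodule.span ℝ {c} = ⊥ := by
    rw [eq_bot_iff]
    rintro a ⟨ha, hac⟩
    obtain ⟨t, rfl⟩ := Submodule.mem_span_singleton.1 hac
    have : t • (1 : Matrix (Fin n) (Fin n) ℝ) = 0 := by
      rw [← hLc, ← map_smul]
      exact ha
    rcases smul_eq_zero.1 this with h | h
    · simp [h]
    · exact absurd h one_ne_zero
  have hc0 : c ≠ 0 := by
    rintro rfl
    rw [map_zero] at hLc
    exact zero_ne_one hLc
  have hdim := Submodule.finrank_sup_add_finrank_inf_eq (LinearMap.ker L) (Submodule.span ℝ {c})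
  rw [← hsup, hinf, finrank_bot, finrank_span_singleton hc0] at hdim
  have hrA := LinearMap.finrank_range_add_finrank_ker A.mulVecLin
  have hrL := LinearMap.finrank_range_add_finrank_ker L
  rw [← Fintype.range_linearCombination ℝ, ← hL]
  unfold Matrix.rank
  omega

/-- Scalings supported in a common independent set coincide. -/
theorem IsScaling.eq_of_linearIndepOn {n k : ℕ} {f : Fin k → Fin n → ℝ} {c d : Fin k → ℝ}
    (hc : IsScaling f c) (hd : IsScaling f d) {b : Finset (Fin k)}
    (hb : LinearIndepOn ℝ (fun i => Matrix.vecMulVec (f i) (f i)) (b : Set (Fin k)))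
    (hcb : suppF c ⊆ b) (hdb : suppF d ⊆ b) : c = d := by
  have hzero : ∀ i ∉ b, c i = 0 ∧ d i = 0 := fun i hi =>
    ⟨by simpa [suppF] using fun h => hi (hcb h), by simpa [suppF] using fun h => hi (hdb h)⟩
  rw [linearIndepOn_finset_iff] at hb
  funext i
  by_cases hi : i ∈ b
  · refine sub_eq_zero.1 (hb (c - d) ?_ i hi)
    rw [Finset.sum_subset (Finset.subset_univ b) fun j _ hj => by simp [hzero j hj]]
    simp [sub_smul, Finset.sum_sub_distrib, hc.2, hd.2]
  · rw [(hzero i hi).1, (hzero i hi).2]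

/-- The number of minimal scalings of a unit-norm frame `F = {f_i}_{i=1}^k` in `ℝⁿ`
is at most `C(k, rank G̃ + 1)`, where `G̃` is the Gramian of the diagram vectors. -/
theorem card_minimal_scalings_le (n k : ℕ) (hn : 2 ≤ n)
    (f : Fin k → Fin n → ℝ) (hF : IsUnitNormFrame f) :
    {c : Fin k → ℝ | IsMinimalScaling f c}.ncard ≤
      Nat.choose k
        ((Matrix.of fun i j : Fin k =>
            ∑ x, diagram n (f j) x * diagram n (f i) x).rank + 1) := by
  have hex : ∀ c : Fin k → ℝ, ∃ b : Finset (Fin k), IsMinimalScaling f c → suppF c ⊆ b ∧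
      LinearIndepOn ℝ (fun i => Matrix.vecMulVec (f i) (f i)) (b : Set (Fin k)) ∧
      b.card = (Matrix.of fun i j : Fin k =>
        ∑ x, diagram n (f j) x * diagram n (f i) x).rank + 1 := fun c => by
    by_cases hc : IsMinimalScaling f c
    · obtain ⟨b, hsb, hb, hcard⟩ :=
        (hc.linearIndepOn hF.1).exists_superset_card_eq_finrank_span
      exact ⟨b, fun _ => ⟨hsb, hb, hcard.trans (hc.1.finrank_span_vecMulVec hn)⟩⟩
    · exact ⟨∅, fun h => absurd h hc⟩
  choose B hB using hex
  set r := (Matrix.of fun i j : Fin k => ∑ x, diagram n (f j) x * diagram n (f i) x).rank + 1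
  calc {c : Fin k → ℝ | IsMinimalScaling f c}.ncard
      ≤ ((Finset.univ.powersetCard r : Finset (Finset (Fin k))) : Set (Finset (Fin k))).ncard := by
        refine Set.ncard_le_ncard_of_injOn B (fun c hc => ?_) (fun c hc d hd hcd => ?_)
          (Finset.finite_toSet _)
        · simpa using (hB c hc).2.2
        · exact hc.1.eq_of_linearIndepOn hd.1 (hB c hc).2.1 (hB c hc).1
            (by rw [hcd]; exact (hB d hd).1)
    _ = Nat.choose k r := by
        rw [Set.ncard_coe_finset, Finset.card_powersetCard, Finset.card_univ, Fintype.card_fin]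
end

section
/- Let {v_i}_{i∈I} be the set of minimal scalings of a scalable unit-norm frame F = {f_i}_{i=1}^k in ℝ^n, and let c be a scaling of F. If {v_i}_{i∈I} is affinely independent, then the elements of the empty cover EC(cF) of the scaled frame cF = {√c(i) f_i}_{i=1}^k are pairwise disjoint. -/
open Finset

/-- The factor poset of a finite family `g` of vectors in `ℝⁿ`: all index sets `J`
such that `{g j}_{j ∈ J}` is a tight frame for `ℝⁿ`, together with `∅`. -/
def FactorPoset {n k : ℕ} (g : Fin k → Fin n → ℝ) : Set (Finset (Fin k)) :=
  {J | ∃ A : ℝ, 0 < A ∧ ∀ x : Fin n → ℝ,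
      ∑ j ∈ J, (∑ l, x l * g j l) ^ 2 = A * ∑ l, x l ^ 2} ∪ {∅}

/-- The empty cover of `g`: the minimal nonempty elements of the factor poset. -/
def EmptyCover {n k : ℕ} (g : Fin k → Fin n → ℝ) : Set (Finset (Fin k)) :=
  {J | J ∈ FactorPoset g ∧ J ≠ ∅ ∧
    ¬ ∃ J' : Finset (Fin k), J' ∈ FactorPoset g ∧ J' ≠ ∅ ∧ J' ⊂ J}

/-- The scaled frame `cF = {√c(i) f_i}`. -/
noncomputable def scaledVec {n k : ℕ} (f : Fin k → Fin n → ℝ) (c : Fin k → ℝ) :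
    Fin k → Fin n → ℝ := fun i => Real.sqrt (c i) • f i

/-- The weighted frame operator `d ↦ ∑ i, d i • f_i f_iᵗ`, linear in the weights. -/
noncomputable def frameOp {n k : ℕ} (f : Fin k → Fin n → ℝ) :
    (Fin k → ℝ) →ₗ[ℝ] Matrix (Fin n) (Fin n) ℝ :=
  Fintype.linearCombination ℝ fun i => Matrix.vecMulVec (f i) (f i)

theorem frameOp_apply {n k : ℕ} (f : Fin k → Fin n → ℝ) (d : Fin k → ℝ) :
    frameOp f d = ∑ i, d i • Matrix.vecMulVec (f i) (f i) := rfl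

theorem isScaling_iff {n k : ℕ} {f : Fin k → Fin n → ℝ} {c : Fin k → ℝ} :
    IsScaling f c ↔ 0 ≤ c ∧ frameOp f c = 1 := Iff.rfl

theorem dotProduct_frameOp_mulVec {n k : ℕ} (f : Fin k → Fin n → ℝ) (d : Fin k → ℝ)
    (x y : Fin n → ℝ) :
    x ⬝ᵥ (frameOp f d).mulVec y = ∑ i, d i * ((x ⬝ᵥ f i) * (y ⬝ᵥ f i)) := by
  simp only [frameOp_apply, Matrix.sum_mulVec, dotProduct_sum, Matrix.smul_mulVec,
    Matrix.vecMulVec_mulVec, dotProduct_smul, smul_eq_mul]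
  refine Finset.sum_congr rfl fun i _ => ?_
  simp [dotProduct_comm y]

/-- Polarization: the weighted frame operator is `A • 1` iff its quadratic form is `A ‖x‖²`. -/
theorem frameOp_eq_smul_one_iff {n k : ℕ} (f : Fin k → Fin n → ℝ) (d : Fin k → ℝ) (A : ℝ) :
    frameOp f d = A • 1 ↔ ∀ x : Fin n → ℝ, ∑ i, d i * (x ⬝ᵥ f i) ^ 2 = A * (x ⬝ᵥ x) := by
  constructor
  · intro h x
    have := dotProduct_frameOp_mulVec f d x x
    simpa [h, Matrix.smul_mulVec, sq] using this.symm
  · intro h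
    ext a b
    have hs := h (Pi.single a 1 + Pi.single b 1)
    have ha := h (Pi.single a 1)
    have hb := h (Pi.single b 1)
    have hM := dotProduct_frameOp_mulVec f d (Pi.single a 1) (Pi.single b 1)
    have hexp : ∑ i, d i * ((Pi.single a 1 + Pi.single b 1 : Fin n → ℝ) ⬝ᵥ f i) ^ 2 =
        ∑ i, d i * ((Pi.single a 1 : Fin n → ℝ) ⬝ᵥ f i) ^ 2 +
        ∑ i, d i * ((Pi.single b 1 : Fin n → ℝ) ⬝ᵥ f i) ^ 2 +
        2 * ∑ i, d i * (((Pi.single a 1 : Fin n → ℝ) ⬝ᵥ f i) *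
          ((Pi.single b 1 : Fin n → ℝ) ⬝ᵥ f i)) := by
      simp only [Finset.mul_sum, ← Finset.sum_add_distrib, add_dotProduct]
      exact Finset.sum_congr rfl fun i _ => by ring
    rw [hexp, ha, hb, ← hM, add_dotProduct, dotProduct_add, dotProduct_add,
      dotProduct_comm (Pi.single b 1) (Pi.single a 1)] at hs
    have hab : (Pi.single a 1 : Fin n → ℝ) ⬝ᵥ Pi.single b 1 = (1 : Matrix _ _ ℝ) a b := by
      simp [Matrix.one_apply, Pi.single_apply, eq_comm]
    have : (Pi.single a 1 : Fin n → ℝ) ⬝ᵥ (frameOp f d).mulVec (Pi.single b 1) =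
        frameOp f d a b := by simp
    rw [this, hab] at hs
    simp only [Matrix.smul_apply, smul_eq_mul]
    linarith

/-- A nonempty subfamily of the scaled frame is tight iff the frame operator of the restricted
weights is a positive multiple of the identity. -/
theorem mem_factorPoset_scaledVec_iff {n k : ℕ} {f : Fin k → Fin n → ℝ} {c : Fin k → ℝ}
    (hc : 0 ≤ c) {J : Finset (Fin k)} (hJ : J ≠ ∅) :
    J ∈ FactorPoset (scaledVec f c) ↔
      ∃ A : ℝ, 0 < A ∧ frameOp f ((J : Set (Fin k)).indicator c) = A • 1 := by
  have key (x : Fin n → ℝ) : ∑ j ∈ J, (∑ l, x l * scaledVec f c j l) ^ 2 =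
      ∑ i, (J : Set (Fin k)).indicator c i * (x ⬝ᵥ f i) ^ 2 := by
    rw [← Finset.sum_subset (Finset.subset_univ J) fun i _ hi => by simp [hi]]
    refine Finset.sum_congr rfl fun i hi => ?_
    change (x ⬝ᵥ (Real.sqrt (c i) • f i)) ^ 2 = _
    simp [hi, mul_pow, Real.sq_sqrt (hc i)]
  simp only [FactorPoset, Set.mem_union, Set.mem_ofPred_eq, Set.mem_singleton_iff, hJ, or_false,
    key, frameOp_eq_smul_one_iff]
  simp only [dotProduct, sq]

theorem trace_frameOp {n k : ℕ} {f : Fin k → Fin n → ℝ} (hf : ∀ i, ∑ l, f i l ^ 2 = 1)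
    (d : Fin k → ℝ) : (frameOp f d).trace = ∑ i, d i := by
  simp only [frameOp_apply, Matrix.trace_sum, Matrix.trace_smul, Matrix.trace_vecMulVec]
  refine Finset.sum_congr rfl fun i _ => ?_
  rw [dotProduct]
  simp only [← sq, hf i, smul_eq_mul, mul_one]

theorem pos_of_frameOp_eq_smul_one {n k : ℕ} {f : Fin k → Fin n → ℝ}
    (hf : ∀ i, ∑ l, f i l ^ 2 = 1) {d : Fin k → ℝ} (hd : 0 ≤ d) (hd0 : d ≠ 0) {t : ℝ}
    (h : frameOp f d = t • 1) : 0 < t := by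
  have htr := trace_frameOp hf d
  have hpos : 0 < ∑ i, d i := by
    obtain ⟨i, hi⟩ := Function.ne_iff.1 hd0
    exact Finset.sum_pos' (fun i _ => hd i)
      ⟨i, Finset.mem_univ i, lt_of_le_of_ne (hd i) (Ne.symm hi)⟩
  rw [← htr, h] at hpos
  simp only [Matrix.trace_smul, Matrix.trace_one, Fintype.card_fin, smul_eq_mul] at hpos
  exact pos_of_mul_pos_left hpos (Nat.cast_nonneg n)

theorem exists_isMinimalScaling_suppF_subset {n k : ℕ} {f : Fin k → Fin n → ℝ}
    {d : Fin k → ℝ} (hd : IsScaling f d) :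
    ∃ w, IsMinimalScaling f w ∧ suppF w ⊆ suppF d := by
  induction hN : #(suppF d) using Nat.strong_induction_on generalizing d with
  | _ N ih =>
    subst hN
    by_cases hmin : IsMinimalScaling f d
    · exact ⟨d, hmin, subset_rfl⟩
    · simp only [IsMinimalScaling, hd, true_and] at hmin
      push Not at hmin
      obtain ⟨S, hS, e, he0, heS, he⟩ := hmin
      have hsub : suppF e ⊆ S := fun i hi => by
        by_contra hiS
        exact mem_suppF.1 hi (heS i hiS)
      obtain ⟨w, hw, hwe⟩ :=
        ih _ (Finset.card_lt_card (hsub.trans_ssubset hS)) ⟨he0, he⟩ rfl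
      exact ⟨w, hw, hwe.trans (hsub.trans hS.subset)⟩

/-- Nonnegative weights whose frame operator is a multiple of the identity lie in the cone
generated by the minimal scalings. -/
theorem exists_nonneg_sum_smul_eq {n k : ℕ} {ι : Type*} [Fintype ι]
    {f : Fin k → Fin n → ℝ} (hf : ∀ i, ∑ l, f i l ^ 2 = 1) (hn : n ≠ 0) {v : ι → Fin k → ℝ}
    (hv : ∀ w, IsMinimalScaling f w → ∃ i, v i = w) {d : Fin k → ℝ} (hd : 0 ≤ d) {t : ℝ}
    (h : frameOp f d = t • 1) : ∃ α : ι → ℝ, 0 ≤ α ∧ ∑ i, α i • v i = d := by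
  classical
  induction hN : #(suppF d) using Nat.strong_induction_on generalizing d t with
  | _ N ih =>
    subst hN
    by_cases hd0 : d = 0
    · exact ⟨0, le_rfl, by simp [hd0]⟩
    have ht := pos_of_frameOp_eq_smul_one hf hd hd0 h
    have hscal : IsScaling f (t⁻¹ • d) :=
      isScaling_iff.2 ⟨smul_nonneg (inv_nonneg.2 ht.le) hd, by
        rw [map_smul, h, smul_smul, inv_mul_cancel₀ ht.ne', one_smul]⟩
    obtain ⟨w, hw, hwd⟩ := exists_isMinimalScaling_suppF_subset hscal
    obtain ⟨hw0, hw1⟩ := isScaling_iff.1 hw.1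
    have hne : (suppF w).Nonempty := by
      rw [Finset.nonempty_iff_ne_empty]
      intro he
      have : w = 0 := funext fun i => by
        by_contra hi
        exact Finset.notMem_empty i (he ▸ mem_suppF.2 hi)
      have := congrArg Matrix.trace hw1
      simp only [‹w = 0›, map_zero, Matrix.trace_zero, Matrix.trace_one, Fintype.card_fin] at this
      exact hn (Nat.cast_eq_zero.1 this.symm)
    obtain ⟨i₀, hi₀, hmin⟩ := Finset.exists_min_image _ (fun i => d i / w i) hne
    have hwpos {i} (hi : i ∈ suppF w) : 0 < w i :=
      lt_of_le_of_ne (hw0 i) (Ne.symm (mem_suppF.1 hi))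
    set ε := d i₀ / w i₀ with hε
    have hε0 : 0 ≤ ε := div_nonneg (hd i₀) (hw0 i₀)
    have hd' : 0 ≤ d - ε • w := fun i => by
      by_cases hi : i ∈ suppF w
      · have := (le_div_iff₀ (hwpos hi)).1 (hmin i hi)
        simpa using this
      · have : w i = 0 := by simpa [mem_suppF] using hi
        simpa [this] using hd i
    have hlt : suppF (d - ε • w) ⊂ suppF d := by
      have hwd' {i} (hi : i ∈ suppF w) : i ∈ suppF d := by
        have := mem_suppF.1 (hwd hi)
        exact mem_suppF.2 fun h0 => this (by simp [h0])
      refine (Finset.ssubset_iff_of_subset fun i hi => ?_).2 ⟨i₀, hwd' hi₀, ?_⟩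
      · by_cases hi' : i ∈ suppF w
        · exact hwd' hi'
        · have : w i = 0 := by simpa [mem_suppF] using hi'
          simpa [mem_suppF, this] using hi
      · simp [mem_suppF, hε, div_mul_cancel₀ _ (hwpos hi₀).ne']
    obtain ⟨α, hα, hsum⟩ := ih _ (Finset.card_lt_card hlt) hd' (t := t - ε)
      (by rw [map_sub, map_smul, h, hw1, sub_smul]) rfl
    obtain ⟨j, hj⟩ := hv w hw
    refine ⟨α + Pi.single j ε, add_nonneg hα (Pi.single_nonneg.2 hε0), ?_⟩
    simp [add_smul, Finset.sum_add_distrib, hsum, Pi.single_apply, ite_smul, hj]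

theorem ne_zero_of_mem_emptyCover {n k : ℕ} {f : Fin k → Fin n → ℝ} (hn : n ≠ 0)
    {c : Fin k → ℝ} (hc : 0 ≤ c) {E : Finset (Fin k)} (hE : E ∈ EmptyCover (scaledVec f c))
    {j : Fin k} (hj : j ∈ E) : c j ≠ 0 := by
  classical
  intro hcj
  obtain ⟨hEF, hE0, hEmin⟩ := hE
  obtain ⟨A, hA, hAE⟩ := (mem_factorPoset_scaledVec_iff hc hE0).1 hEF
  have hind : ((E.erase j : Finset (Fin k)) : Set (Fin k)).indicator c =
      (E : Set (Fin k)).indicator c := by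
    ext i
    by_cases hij : i = j
    · subst hij
      simp [Set.indicator_apply, hcj]
    · simp [Set.indicator_apply, hij]
  have hne : E.erase j ≠ ∅ := fun h0 => by
    have h1 := congrArg Matrix.trace hAE
    rw [← hind, h0, Finset.coe_empty, Set.indicator_empty', map_zero] at h1
    simp [hA.ne', hn] at h1
  exact hEmin ⟨E.erase j, (mem_factorPoset_scaledVec_iff hc hne).2 ⟨A, hA, hind ▸ hAE⟩, hne,
    Finset.erase_ssubset hj⟩

/-- The weights `c` split along a factor `E` into two conic combinations of minimal scalings. -/
theorem exists_nonneg_sum_smul_eq_indicator {n k : ℕ} {ι : Type*} [Fintype ι]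
    {f : Fin k → Fin n → ℝ} (hf : ∀ i, ∑ l, f i l ^ 2 = 1) (hn : n ≠ 0) {v : ι → Fin k → ℝ}
    (hv : ∀ w, IsMinimalScaling f w → ∃ i, v i = w) {c : Fin k → ℝ} (hc : IsScaling f c)
    {E : Finset (Fin k)} (hE : E ∈ FactorPoset (scaledVec f c)) (hE0 : E ≠ ∅) :
    ∃ α β : ι → ℝ, 0 ≤ α ∧ 0 ≤ β ∧ ∑ i, α i • v i = (E : Set (Fin k)).indicator c ∧
      ∑ i, β i • v i = (E : Set (Fin k))ᶜ.indicator c := by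
  obtain ⟨hc0, hc1⟩ := isScaling_iff.1 hc
  obtain ⟨A, -, hA⟩ := (mem_factorPoset_scaledVec_iff hc0 hE0).1 hE
  have hA' : frameOp f ((E : Set (Fin k))ᶜ.indicator c) = (1 - A) • 1 := by
    rw [Set.indicator_compl, map_sub, hc1, hA, sub_smul, one_smul]
  obtain ⟨α, hα, hαs⟩ := exists_nonneg_sum_smul_eq hf hn hv
    (fun i => Set.indicator_nonneg (fun i _ => hc0 i) i) hA
  obtain ⟨β, hβ, hβs⟩ := exists_nonneg_sum_smul_eq hf hn hv
    (fun i => Set.indicator_nonneg (fun i _ => hc0 i) i) hA'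
  exact ⟨α, β, hα, hβ, hαs, hβs⟩

/-- If a conic combination of nonnegative vectors is supported in `s`, so is every term. -/
theorem mul_eq_zero_of_sum_smul_eq_indicator {κ ι : Type*} [Fintype ι] {v : ι → κ → ℝ}
    (hv : ∀ i, 0 ≤ v i) {α : ι → ℝ} (hα : 0 ≤ α) {s : Set κ} {c : κ → ℝ}
    (h : ∑ i, α i • v i = s.indicator c) {j : κ} (hj : j ∉ s) (i : ι) : α i * v i j = 0 := by
  have := congrFun h j
  simp only [Finset.sum_apply, Pi.smul_apply, smul_eq_mul, Set.indicator_of_notMem hj] at this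
  exact (Finset.sum_eq_zero_iff_of_nonneg fun i _ => mul_nonneg (hα i) (hv i j)).1 this i
    (Finset.mem_univ i)

theorem inter_mem_factorPoset {n k : ℕ} {ι : Type*} [Fintype ι]
    {f : Fin k → Fin n → ℝ} (hf : ∀ i, ∑ l, f i l ^ 2 = 1) (hn : n ≠ 0) {v : ι → Fin k → ℝ}
    (hv : ∀ w, IsMinimalScaling f w ↔ ∃ i, v i = w)
    (haff : ∀ α : ι → ℝ, ∑ i, α i • v i = 0 → ∑ i, α i = 0 → ∀ i, α i = 0)
    {c : Fin k → ℝ} (hc : IsScaling f c) {E₁ E₂ : Finset (Fin k)}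
    (h₁ : E₁ ∈ FactorPoset (scaledVec f c)) (h₂ : E₂ ∈ FactorPoset (scaledVec f c))
    {j : Fin k} (hj₁ : j ∈ E₁) (hj₂ : j ∈ E₂) (hcj : c j ≠ 0) :
    E₁ ∩ E₂ ∈ FactorPoset (scaledVec f c) := by
  classical
  have hvs (i : ι) : 0 ≤ v i ∧ frameOp f (v i) = 1 := isScaling_iff.1 ((hv _).2 ⟨i, rfl⟩).1
  have hc0 := (isScaling_iff.1 hc).1
  have hop (α : ι → ℝ) : frameOp f (∑ i, α i • v i) = (∑ i, α i) • 1 := by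
    simp [map_sum, (hvs _).2, Finset.sum_smul]
  obtain ⟨α, α', hα, hα', hαs, hαs'⟩ := exists_nonneg_sum_smul_eq_indicator hf hn
    (fun w => (hv w).1) hc h₁ (Finset.ne_empty_of_mem hj₁)
  obtain ⟨β, β', hβ, hβ', hβs, hβs'⟩ := exists_nonneg_sum_smul_eq_indicator hf hn
    (fun w => (hv w).1) hc h₂ (Finset.ne_empty_of_mem hj₂)
  have hsum : ∑ i, (α + α' - (β + β')) i • v i = 0 := by
    simp only [Pi.sub_apply, Pi.add_apply, sub_smul, add_smul, Finset.sum_sub_distrib,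
      Finset.sum_add_distrib, hαs, hαs', hβs, hβs', Set.indicator_self_add_compl, sub_self]
  have hsum' : ∑ i, (α + α' - (β + β')) i = 0 := by
    have := congrArg Matrix.trace (hop (α + α' - (β + β')))
    rw [hsum] at this
    simpa only [map_zero, Matrix.trace_zero, Matrix.trace_smul, Matrix.trace_one,
      Fintype.card_fin, smul_eq_mul, zero_eq_mul, Nat.cast_eq_zero, hn, or_false] using this
  have heq (i : ι) : α i + α' i = β i + β' i := sub_eq_zero.1 (haff _ hsum hsum' i)
  have hα0 {i l} (hl : l ∉ E₁) := mul_eq_zero_of_sum_smul_eq_indicator (fun i => (hvs i).1)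
    hα hαs (j := l) (by simpa using hl) i
  have hβ0 {i l} (hl : l ∉ E₂) := mul_eq_zero_of_sum_smul_eq_indicator (fun i => (hvs i).1)
    hβ hβs (j := l) (by simpa using hl) i
  have hβ0' {i l} (hl : l ∈ E₂) := mul_eq_zero_of_sum_smul_eq_indicator (fun i => (hvs i).1)
    hβ' hβs' (j := l) (by simpa using hl) i
  -- keep the terms of the first decomposition whose support also lies in `E₂`
  let γ : ι → ℝ := fun i => if ∀ l ∉ E₂, v i l = 0 then α i else 0
  have hγ : ∑ i, γ i • v i = ((E₁ ∩ E₂ : Finset (Fin k)) : Set (Fin k)).indicator c := by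
    ext l
    have hαl := congrFun hαs l
    simp only [Finset.sum_apply, Pi.smul_apply, smul_eq_mul] at hαl ⊢
    by_cases hl₂ : l ∈ E₂
    · have : (E₁ : Set (Fin k)).indicator c l =
          ((E₁ ∩ E₂ : Finset (Fin k)) : Set (Fin k)).indicator c l := by
        simp [Set.indicator_apply, hl₂]
      rw [← this, ← hαl]
      refine Finset.sum_congr rfl fun i _ => ?_
      by_cases hi : ∀ l ∉ E₂, v i l = 0
      · simp only [γ, if_pos hi]
      · simp only [γ, if_neg hi, zero_mul]
        push Not at hi
        obtain ⟨p, hp, hvp⟩ := hi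
        have hβi : β i = 0 := (mul_eq_zero.1 (hβ0 hp)).resolve_right hvp
        rcases mul_eq_zero.1 (hβ0' (i := i) hl₂) with hb | hb
        · have := heq i
          have h1 := hα i
          have h2 := hα' i
          simp only [Pi.zero_apply] at h1 h2
          have : α i = 0 := by linarith
          simp [this]
        · simp [hb]
    · rw [Set.indicator_of_notMem (by simp [hl₂])]
      refine Finset.sum_eq_zero fun i _ => ?_
      by_cases hi : ∀ l ∉ E₂, v i l = 0
      · simp [hi l hl₂]
      · simp [γ, hi]
  have hjm : j ∈ E₁ ∩ E₂ := Finset.mem_inter.2 ⟨hj₁, hj₂⟩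
  have hop' := hop γ
  rw [hγ] at hop'
  refine (mem_factorPoset_scaledVec_iff hc0 (Finset.ne_empty_of_mem hjm)).2 ⟨_, ?_, hop'⟩
  refine pos_of_frameOp_eq_smul_one hf (fun i => Set.indicator_nonneg (fun i _ => hc0 i) i)
    (fun h0 => hcj ?_) hop'
  have := congrFun h0 j
  rwa [Set.indicator_of_mem (Finset.mem_coe.2 hjm)] at this

/-- If the minimal scalings of a scalable unit-norm frame `F` are affinely
independent, then for any scaling `c` of `F` the elements of the empty cover of
the scaled frame `cF` are pairwise disjoint. -/
theorem emptyCover_pairwise_disjoint_of_affine_independent (n k m : ℕ)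
    (f : Fin k → Fin n → ℝ) (hF : IsUnitNormFrame f)
    (v : Fin m → Fin k → ℝ) (hvinj : Function.Injective v)
    (hrange : Set.range v = {c : Fin k → ℝ | IsMinimalScaling f c})
    (haffind : ∀ α : Fin m → ℝ,
      ∑ i, α i • v i = 0 → ∑ i, α i = 0 → ∀ i, α i = 0)
    (c : Fin k → ℝ) (hc : IsScaling f c) :
    ∀ E₁ ∈ EmptyCover (scaledVec f c), ∀ E₂ ∈ EmptyCover (scaledVec f c),
      E₁ ≠ E₂ → Disjoint E₁ E₂ := by
  intro E₁ h₁ E₂ h₂ hne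
  rw [Finset.disjoint_left]
  intro j hj₁ hj₂
  have hn : n ≠ 0 := by
    rintro rfl
    simpa using hF.1 j
  have hcj := ne_zero_of_mem_emptyCover hn hc.1 h₁ hj₁
  have hv (w : Fin k → ℝ) : IsMinimalScaling f w ↔ ∃ i, v i = w :=
    (Set.ext_iff.1 hrange w).symm
  have hmem := inter_mem_factorPoset hF.1 hn hv haffind hc h₁.1 h₂.1 hj₁ hj₂ hcj
  have hne0 : E₁ ∩ E₂ ≠ ∅ := Finset.ne_empty_of_mem (Finset.mem_inter.2 ⟨hj₁, hj₂⟩)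
  have eq_of {E} (hE : E ∈ EmptyCover (scaledVec f c)) (hsub : E₁ ∩ E₂ ⊆ E) : E₁ ∩ E₂ = E :=
    by_contra fun h => hE.2.2 ⟨_, hmem, hne0, hsub.ssubset_of_ne h⟩
  exact hne ((eq_of h₁ Finset.inter_subset_left).symm.trans (eq_of h₂ Finset.inter_subset_right))
end

section
/- Let ℳ(F) be the set of minimal scalings of a scalable unit-norm frame F = {f_i}_{i=1}^k in ℝ^n, and suppose f_{k+1} = f_{i₀} for some i₀ ∈ {1,…,k}. Then the set of minimal scalings of the extended frame {f_i}_{i=1}^{k+1} equals { (v(1),…,v(k),0) : v ∈ ℳ(F) } ∪ { (v(1),…,v(i₀−1),0,v(i₀+1),…,v(k),v(i₀)) : v ∈ ℳ(F) }; in particular, the number of minimal scalings doubles when each minimal scaling has i₀ in its support. -/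
open Finset

/-- Minimality of a scaling, phrased through the zero patterns of the other scalings. -/
lemma isMinimalScaling_iff {n k : ℕ} (f : Fin k → Fin n → ℝ) (c : Fin k → ℝ) :
    IsMinimalScaling f c ↔ IsScaling f c ∧
      ∀ e, IsScaling f e → (∀ i, c i = 0 → e i = 0) → ∀ i, e i = 0 → c i = 0 := by
  refine and_congr_right fun _ => ⟨fun h e he hce i hei => ?_, ?_⟩
  · by_contra hci
    refine h (suppF e) ?_ ⟨e, he.1, fun j hj => by simpa [suppF] using hj, he.2⟩
    rw [Finset.ssubset_iff_of_subset]
    · exact ⟨i, by simpa [suppF] using hci, by simpa [suppF] using hei⟩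
    · intro j hj
      simp only [suppF, Finset.mem_filter, Finset.mem_univ, true_and] at hj ⊢
      exact fun hcj => hj (hce j hcj)
  · rintro h S hS ⟨e, he, heS, hsum⟩
    obtain ⟨i, hic, hiS⟩ := Finset.exists_of_ssubset hS
    have hci : c i ≠ 0 := by simpa [suppF] using hic
    refine hci (h e ⟨he, hsum⟩ (fun j hcj => heS j fun hjS => ?_) i (heS i hiS))
    have hj := hS.1 hjS
    simp [suppF, hcj] at hj

/-- Scalings of a family with a repeated vector are obtained by splitting a weight. -/
lemma isScaling_snoc_iff {n k : ℕ} (f : Fin k → Fin n → ℝ) (i₀ : Fin k)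
    (v : Fin k → ℝ) (a : ℝ) :
    IsScaling (Fin.snoc f (f i₀)) (Fin.snoc v a) ↔
      (∀ i, 0 ≤ v i) ∧ 0 ≤ a ∧ IsScaling f (v + Pi.single i₀ a) := by
  have hsum : ∑ i, (v + Pi.single i₀ a : Fin k → ℝ) i • Matrix.vecMulVec (f i) (f i) =
      ∑ i, v i • Matrix.vecMulVec (f i) (f i) + a • Matrix.vecMulVec (f i₀) (f i₀) := by
    simp [add_smul, Finset.sum_add_distrib, Pi.single_apply, ite_smul]
  simp only [IsScaling, hsum, Fin.forall_fin_succ', Fin.sum_univ_castSucc, Fin.snoc_castSucc,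
    Fin.snoc_last]
  constructor
  · rintro ⟨⟨hv, ha⟩, h⟩
    have hsingle : (0 : Fin k → ℝ) ≤ Pi.single i₀ a := Pi.single_nonneg.2 ha
    exact ⟨hv, ha, fun i => add_nonneg (hv i) (hsingle i), h⟩
  · rintro ⟨hv, ha, -, h⟩
    exact ⟨⟨hv, ha⟩, h⟩

lemma update_zero_add_single {k : ℕ} (v : Fin k → ℝ) (i₀ : Fin k) :
    Function.update v i₀ 0 + Pi.single i₀ (v i₀) = v := by
  ext i
  by_cases hi : i = i₀
  · subst hi; simp
  · simp [hi]

lemma isScaling_snoc_zero_iff {n k : ℕ} (f : Fin k → Fin n → ℝ) (i₀ : Fin k) (v : Fin k → ℝ) :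
    IsScaling (Fin.snoc f (f i₀)) (Fin.snoc v 0) ↔ IsScaling f v := by
  rw [isScaling_snoc_iff]
  simp only [Pi.single_zero, add_zero, le_refl, true_and]
  exact ⟨fun h => h.2, fun h => ⟨h.1, h⟩⟩

lemma isScaling_snoc_update_iff {n k : ℕ} (f : Fin k → Fin n → ℝ) (i₀ : Fin k)
    (v : Fin k → ℝ) :
    IsScaling (Fin.snoc f (f i₀)) (Fin.snoc (Function.update v i₀ 0) (v i₀)) ↔
      IsScaling f v := by
  rw [isScaling_snoc_iff, update_zero_add_single]
  refine ⟨fun h => h.2.2, fun h => ⟨fun i => ?_, h.1 i₀, h⟩⟩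
  by_cases hi : i = i₀
  · subst hi; simp
  · simpa [hi] using h.1 i

lemma isMinimalScaling_snoc_zero_iff {n k : ℕ} (f : Fin k → Fin n → ℝ) (i₀ : Fin k)
    (v : Fin k → ℝ) :
    IsMinimalScaling (Fin.snoc f (f i₀)) (Fin.snoc v 0) ↔ IsMinimalScaling f v := by
  rw [isMinimalScaling_iff, isMinimalScaling_iff, isScaling_snoc_zero_iff]
  refine and_congr_right fun _ => ⟨fun h e he hve i hei => ?_, fun h e he hve => ?_⟩
  · have := h (Fin.snoc e 0) ((isScaling_snoc_zero_iff f i₀ e).2 he)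
      (by simpa [Fin.forall_fin_succ'] using hve) i.castSucc (by simpa using hei)
    simpa using this
  · obtain ⟨w, a, rfl⟩ : ∃ (w : Fin k → ℝ) (a : ℝ), e = Fin.snoc w a :=
      ⟨Fin.init e, e (Fin.last k), (Fin.snoc_init_self e).symm⟩
    simp only [Fin.forall_fin_succ', Fin.snoc_castSucc, Fin.snoc_last, forall_const] at hve ⊢
    obtain ⟨hvw, rfl⟩ := hve
    exact ⟨h w ((isScaling_snoc_zero_iff f i₀ w).1 he) hvw, fun _ => trivial⟩

lemma isMinimalScaling_snoc_update_iff {n k : ℕ} (f : Fin k → Fin n → ℝ) (i₀ : Fin k)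
    (v : Fin k → ℝ) :
    IsMinimalScaling (Fin.snoc f (f i₀)) (Fin.snoc (Function.update v i₀ 0) (v i₀)) ↔
      IsMinimalScaling f v := by
  have hzero : ∀ w : Fin k → ℝ, ∀ i, Function.update w i₀ 0 i = 0 ↔ (i = i₀ ∨ w i = 0) := by
    intro w i
    by_cases hi : i = i₀
    · subst hi; simp
    · simp [hi]
  rw [isMinimalScaling_iff, isMinimalScaling_iff, isScaling_snoc_update_iff]
  refine and_congr_right fun _ => ⟨fun h e he hve => ?_, fun h e he hve => ?_⟩
  · have := h _ ((isScaling_snoc_update_iff f i₀ e).2 he)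
    simp only [Fin.forall_fin_succ', Fin.snoc_castSucc, Fin.snoc_last, hzero] at this
    obtain ⟨h₁, h₂⟩ := this ⟨fun i hi => hi.imp_right (hve i), hve i₀⟩
    intro i hi
    rcases h₁ i (Or.inr hi) with rfl | hvi
    · exact h₂ hi
    · exact hvi
  · obtain ⟨w, a, rfl⟩ : ∃ (w : Fin k → ℝ) (a : ℝ), e = Fin.snoc w a :=
      ⟨Fin.init e, e (Fin.last k), (Fin.snoc_init_self e).symm⟩
    simp only [Fin.forall_fin_succ', Fin.snoc_castSucc, Fin.snoc_last, hzero] at hve ⊢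
    obtain ⟨hvw, hva⟩ := hve
    have hw : w i₀ = 0 := hvw i₀ (Or.inl rfl)
    have key := h _ ((isScaling_snoc_iff f i₀ w a).1 he).2.2 fun i hi => by
      by_cases hii : i = i₀
      · subst hii; simp [hw, hva hi]
      · simp [hii, hvw i (Or.inr hi)]
    refine ⟨fun i hi => ?_, fun ha => key i₀ (by simp [hw, ha])⟩
    by_cases hii : i = i₀
    · exact Or.inl hii
    · exact Or.inr (key i (by simp [hii, hi]))

/-- A minimal scaling never gives positive weight to both copies of a repeated vector. -/
lemma IsMinimalScaling.eq_zero_or_eq_zero {n k : ℕ} {f : Fin k → Fin n → ℝ} {i₀ : Fin k}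
    {v : Fin k → ℝ} {a : ℝ} (h : IsMinimalScaling (Fin.snoc f (f i₀)) (Fin.snoc v a)) :
    a = 0 ∨ v i₀ = 0 := by
  by_contra! hne
  obtain ⟨hs, hmin⟩ := (isMinimalScaling_iff _ _).1 h
  have hmerge := (isScaling_snoc_zero_iff f i₀ _).2 ((isScaling_snoc_iff f i₀ v a).1 hs).2.2
  have hlast := hmin _ hmerge ?_ (Fin.last k) (by simp)
  · exact hne.1 (by simpa using hlast)
  · simp only [Fin.forall_fin_succ', Fin.snoc_castSucc, Fin.snoc_last, implies_true, and_true]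
    intro i hi
    have hii : i ≠ i₀ := by
      rintro rfl
      exact hne.2 hi
    simp [hii, hi]

/-- If the vector `f i₀` is repeated as a `(k+1)`-st frame vector, then the
minimal scalings of the extended frame are exactly the minimal scalings `v` of
`F` extended by `0`, together with the vectors obtained from such `v` by moving
the weight `v i₀` to the last coordinate.  In particular, if every minimal
scaling of `F` has `i₀` in its support, the number of minimal scalings doubles. -/
theorem minimal_scalings_of_repeated_vector (n k : ℕ)
    (f : Fin k → Fin n → ℝ) (hF : IsUnitNormFrame f)
    (hscalable : ∃ c, IsScaling f c) (i₀ : Fin k) :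
    ({d : Fin (k + 1) → ℝ | IsMinimalScaling (Fin.snoc f (f i₀)) d} =
      {d | ∃ v : Fin k → ℝ, IsMinimalScaling f v ∧ d = Fin.snoc v 0} ∪
      {d | ∃ v : Fin k → ℝ, IsMinimalScaling f v ∧
        d = Fin.snoc (Function.update v i₀ 0) (v i₀)}) ∧
    ((∀ v : Fin k → ℝ, IsMinimalScaling f v → v i₀ ≠ 0) →
      {d : Fin (k + 1) → ℝ | IsMinimalScaling (Fin.snoc f (f i₀)) d}.ncard =
        2 * {v : Fin k → ℝ | IsMinimalScaling f v}.ncard) := by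
  have hset : {d : Fin (k + 1) → ℝ | IsMinimalScaling (Fin.snoc f (f i₀)) d} =
      {d | ∃ v : Fin k → ℝ, IsMinimalScaling f v ∧ d = Fin.snoc v 0} ∪
      {d | ∃ v : Fin k → ℝ, IsMinimalScaling f v ∧
        d = Fin.snoc (Function.update v i₀ 0) (v i₀)} := by
    ext d
    simp only [Set.mem_union, Set.mem_ofPred_eq]
    constructor
    · intro hd
      obtain ⟨w, a, rfl⟩ : ∃ (w : Fin k → ℝ) (a : ℝ), d = Fin.snoc w a :=
        ⟨Fin.init d, d (Fin.last k), (Fin.snoc_init_self d).symm⟩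
      rcases hd.eq_zero_or_eq_zero with rfl | hw
      · exact Or.inl ⟨w, (isMinimalScaling_snoc_zero_iff f i₀ w).1 hd, rfl⟩
      · have hwa : (Fin.snoc w a : Fin (k + 1) → ℝ) =
            Fin.snoc (Function.update (Function.update w i₀ a) i₀ 0)
              (Function.update w i₀ a i₀) := by
          rw [Function.update_idem, Function.update_self, ← hw, Function.update_eq_self]
        rw [hwa] at hd ⊢
        exact Or.inr ⟨_, (isMinimalScaling_snoc_update_iff f i₀ _).1 hd, rfl⟩
    · rintro (⟨v, hv, rfl⟩ | ⟨v, hv, rfl⟩)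
      · exact (isMinimalScaling_snoc_zero_iff f i₀ v).2 hv
      · exact (isMinimalScaling_snoc_update_iff f i₀ v).2 hv
  refine ⟨hset, fun hsupp => ?_⟩
  have himage : ∀ g : (Fin k → ℝ) → Fin (k + 1) → ℝ,
      {d | ∃ v : Fin k → ℝ, IsMinimalScaling f v ∧ d = g v} =
        g '' {v | IsMinimalScaling f v} := by
    intro g
    ext d
    simp [eq_comm]
  have hinj₀ : Function.Injective fun v : Fin k → ℝ => (Fin.snoc v 0 : Fin (k + 1) → ℝ) :=
    fun v w h => (Fin.snoc_inj.1 h).1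
  have hinj₁ : Function.Injective fun v : Fin k → ℝ =>
      (Fin.snoc (Function.update v i₀ 0) (v i₀) : Fin (k + 1) → ℝ) := by
    intro v w h
    obtain ⟨h₁, h₂⟩ := Fin.snoc_inj.1 h
    rw [← update_zero_add_single v i₀, ← update_zero_add_single w i₀, h₁, h₂]
  rw [hset, himage fun v => Fin.snoc v 0,
    himage fun v => Fin.snoc (Function.update v i₀ 0) (v i₀), Set.ncard_def,
    Set.encard_union_eq, hinj₀.encard_image, hinj₁.encard_image, ← two_mul, ENat.toNat_mul]
  · rfl
  · rw [Set.disjoint_left]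
    rintro _ ⟨v, -, rfl⟩ ⟨w, hw, h⟩
    exact hsupp w hw (Fin.snoc_inj.1 h).2
end
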